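/- arXiv:1208.3346 — 7 statements merged into one kernel-verified Lean document; each statement's English description precedes it below -/
import Mathlib

section
/- Let n ≥ 1 and w : Fin n → ℤ, and suppose w is not partitionable. Then there exist rational numbers c i S, indexed by i : Fin n and even-cardinality Finsets S ⊆ Fin n with i ∉ S, and rational numbers b S, indexed by odd-cardinality Finsets S ⊆ Fin n, such that in MvPolynomial (Fin n) ℚ one has 1 = ∑_{i : Fin n} (∑_{S ⊆ Fin n, i ∉ S, S.card even} c i S • X^S) * (X i ^ 2 − 1) + (∑_{S ⊆ Fin n, S.card odd} b S • X^S) * L. -/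
open Finset MvPolynomial

/-- `w : Fin n → ℤ` is *partitionable* if there is a subset `I` of `Fin n` whose
sum equals the sum of its complement. -/
def Partitionable (n : ℕ) (w : Fin n → ℤ) : Prop :=
  ∃ I : Finset (Fin n), ∑ i ∈ I, w i = ∑ i ∈ Iᶜ, w i

open scoped symmDiff

/-- Multiplying the monomial of `S` by `f i` toggles `i` in `S`, up to a multiple of
`f i ^ 2 - 1`. -/
lemma prod_mul_eq_prod_symmDiff_singleton_add {α R : Type*} [DecidableEq α] [CommRing R]
    (f : α → R) (S : Finset α) (i : α) :
    (∏ j ∈ S, f j) * f i = (∏ j ∈ S ∆ {i}, f j) +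
      if i ∈ S then (∏ j ∈ S.erase i, f j) * (f i ^ 2 - 1) else 0 := by
  by_cases h : i ∈ S
  · have hs : S ∆ {i} = S.erase i := by
      ext x
      simp only [mem_symmDiff, mem_singleton, mem_erase]
      grind
    rw [if_pos h, hs, ← mul_prod_erase S f h]
    ring
  · have hs : S ∆ {i} = insert i S := by
      ext x
      simp only [mem_symmDiff, mem_singleton, mem_insert]
      grind
    rw [if_neg h, hs, prod_insert h]
    ring

lemma sum_symmDiff_eq_sum {α M : Type*} [Fintype α] [DecidableEq α] [AddCommMonoid M]
    (A : Finset α) (f : Finset α → M) : ∑ S, f (S ∆ A) = ∑ S, f S :=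
  Fintype.sum_equiv (Function.Involutive.toPerm (· ∆ A) fun S => symmDiff_symmDiff_cancel_right A S)
    _ _ fun _ => rfl

/-- The vertex of the hypercube `{1, -1} ^ α` which is `-1` exactly on `U`. -/
def signVertex {α : Type*} [DecidableEq α] (U : Finset α) (i : α) : ℚ :=
  if i ∈ U then -1 else 1

lemma signVertex_sq {α : Type*} [DecidableEq α] (U : Finset α) (i : α) :
    signVertex U i ^ 2 = 1 := by
  unfold signVertex
  split_ifs <;> norm_num

lemma signVertex_compl {α : Type*} [Fintype α] [DecidableEq α] (U : Finset α) (i : α) :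
    signVertex Uᶜ i = -signVertex U i := by
  by_cases h : i ∈ U <;> simp [signVertex, h]

lemma prod_signVertex_symmDiff_singleton {α : Type*} [DecidableEq α] (U T : Finset α) (i : α) :
    ∏ j ∈ T ∆ {i}, signVertex U j = (∏ j ∈ T, signVertex U j) * signVertex U i := by
  rw [prod_mul_eq_prod_symmDiff_singleton_add, signVertex_sq]
  simp

/-- Orthogonality of the characters of the hypercube to the trivial character. -/
lemma sum_prod_signVertex {α : Type*} [Fintype α] [DecidableEq α] (T : Finset α) :
    ∑ U : Finset α, ∏ j ∈ T, signVertex U j = if T = ∅ then 2 ^ Fintype.card α else 0 := by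
  split_ifs with hT
  · simp [hT]
  · obtain ⟨i, hi⟩ := nonempty_iff_ne_empty.mpr hT
    have key : ∀ U : Finset α,
        ∏ j ∈ T, signVertex (U ∆ {i}) j = -∏ j ∈ T, signVertex U j := by
      intro U
      rw [← mul_prod_erase T _ hi, ← mul_prod_erase T _ hi, ← neg_mul]
      congr 1
      · by_cases h : i ∈ U <;> simp [signVertex, mem_symmDiff, h]
      · refine prod_congr rfl fun j hj => ?_
        simp [signVertex, mem_symmDiff, ne_of_mem_erase hj]
    have h := sum_symmDiff_eq_sum {i} fun U => ∏ j ∈ T, signVertex U j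
    simp only [key, sum_neg_distrib] at h
    linarith

/-- The coefficients of the multilinear interpolation of `1 / ∑ i, w i * x i` on the hypercube. -/
def reciprocalCoeff {α : Type*} [Fintype α] [DecidableEq α] (w : α → ℚ) (S : Finset α) : ℚ :=
  (2 ^ Fintype.card α)⁻¹ *
    ∑ U : Finset α, (∏ j ∈ S, signVertex U j) * (∑ i, w i * signVertex U i)⁻¹

lemma reciprocalCoeff_eq_zero_of_even {α : Type*} [Fintype α] [DecidableEq α] (w : α → ℚ)
    {S : Finset α} (hS : Even #S) : reciprocalCoeff w S = 0 := by
  have h : ∑ U : Finset α, (∏ j ∈ S, signVertex Uᶜ j) * (∑ i, w i * signVertex Uᶜ i)⁻¹ =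
      ∑ U : Finset α, (∏ j ∈ S, signVertex U j) * (∑ i, w i * signVertex U i)⁻¹ :=
    Fintype.sum_equiv (Function.Involutive.toPerm compl compl_compl) _ _ fun _ => rfl
  simp only [signVertex_compl, prod_neg, hS.neg_one_pow, one_mul, mul_neg, sum_neg_distrib,
    inv_neg] at h
  rw [reciprocalCoeff, mul_eq_zero]
  right
  linarith

lemma sum_mul_reciprocalCoeff_symmDiff {α : Type*} [Fintype α] [DecidableEq α] {w : α → ℚ}
    (hw : ∀ U : Finset α, ∑ i, w i * signVertex U i ≠ 0) (T : Finset α) :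
    ∑ i, w i * reciprocalCoeff w (T ∆ {i}) = if T = ∅ then 1 else 0 := by
  have h : ∑ i, w i * reciprocalCoeff w (T ∆ {i}) =
      (2 ^ Fintype.card α)⁻¹ * ∑ U : Finset α, ∏ j ∈ T, signVertex U j := by
    simp only [reciprocalCoeff, prod_signVertex_symmDiff_singleton, mul_sum]
    rw [sum_comm]
    refine sum_congr rfl fun U _ => ?_
    calc _ = ∑ i, (2 ^ Fintype.card α)⁻¹ * (∏ j ∈ T, signVertex U j) *
          (∑ i, w i * signVertex U i)⁻¹ * (w i * signVertex U i) :=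
          sum_congr rfl fun i _ => by ring
      _ = _ := by rw [← mul_sum, mul_assoc, inv_mul_cancel₀ (hw U), mul_one]
  rw [h, sum_prod_signVertex]
  split_ifs <;> simp

lemma sum_mul_signVertex_ne_zero {n : ℕ} {w : Fin n → ℤ} (hw : ¬ Partitionable n w)
    (U : Finset (Fin n)) : ∑ i, (w i : ℚ) * signVertex U i ≠ 0 := by
  intro h
  refine hw ⟨U, ?_⟩
  rw [← sum_add_sum_compl U] at h
  have h₁ : ∑ i ∈ U, (w i : ℚ) * signVertex U i = -∑ i ∈ U, (w i : ℚ) := by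
    rw [← sum_neg_distrib]
    exact sum_congr rfl fun i hi => by simp [signVertex, hi]
  have h₂ : ∑ i ∈ Uᶜ, (w i : ℚ) * signVertex U i = ∑ i ∈ Uᶜ, (w i : ℚ) :=
    sum_congr rfl fun i hi => by simp [signVertex, mem_compl.mp hi]
  rw [h₁, h₂] at h
  have h₃ : ∑ i ∈ U, (w i : ℚ) = ∑ i ∈ Uᶜ, (w i : ℚ) := by linarith
  exact_mod_cast h₃

/-- Multiplying a multilinear polynomial by `X i` and reducing modulo `X i ^ 2 - 1`. -/
lemma sum_smul_prod_X_mul_X {α R : Type*} [Fintype α] [DecidableEq α] [CommRing R]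
    (b : Finset α → R) (i : α) :
    (∑ S, b S • ∏ j ∈ S, (X j : MvPolynomial α R)) * X i =
      ∑ S, b (S ∆ {i}) • ∏ j ∈ S, X j +
        (∑ S with i ∉ S, b (insert i S) • ∏ j ∈ S, X j) * (X i ^ 2 - 1) := by
  have h₁ : ∑ S, b (S ∆ {i}) • ∏ j ∈ S, (X j : MvPolynomial α R) =
      ∑ S, b S • ∏ j ∈ S ∆ {i}, X j := by
    rw [← sum_symmDiff_eq_sum {i}]
    simp only [symmDiff_symmDiff_cancel_right]
  have h₂ : ∑ S with i ∉ S, b (insert i S) • ∏ j ∈ S, (X j : MvPolynomial α R) =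
      ∑ S with i ∈ S, b S • ∏ j ∈ S.erase i, X j := by
    refine sum_nbij' (insert i) (fun S => S.erase i) ?_ ?_ ?_ ?_ ?_ <;>
      simp +contextual [insert_erase]
  rw [h₁, h₂, sum_mul, sum_mul, sum_filter, ← sum_add_distrib]
  refine sum_congr rfl fun S _ => ?_
  rw [smul_mul_assoc, prod_mul_eq_prod_symmDiff_singleton_add, smul_add]
  split_ifs <;> simp

theorem stmt_1 (n : ℕ) (hn : 1 ≤ n) (w : Fin n → ℤ) (hw : ¬ Partitionable n w) :
    ∃ (c : Fin n → Finset (Fin n) → ℚ) (b : Finset (Fin n) → ℚ),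
      (1 : MvPolynomial (Fin n) ℚ) =
        (∑ i : Fin n,
          (∑ S ∈ Finset.univ.filter (fun S : Finset (Fin n) => i ∉ S ∧ Even S.card),
              c i S • ∏ j ∈ S, (X j : MvPolynomial (Fin n) ℚ)) * (X i ^ 2 - 1))
        + (∑ S ∈ Finset.univ.filter (fun S : Finset (Fin n) => Odd S.card),
              b S • ∏ j ∈ S, (X j : MvPolynomial (Fin n) ℚ)) *
            (∑ i : Fin n, C (w i : ℚ) * X i) := by
  set v : Fin n → ℚ := fun i => w i
  obtain ⟨b, b_even, b_sum⟩ : ∃ b : Finset (Fin n) → ℚ, (∀ S, Even #S → b S = 0) ∧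
      ∀ T, ∑ i, v i * b (T ∆ {i}) = if T = ∅ then 1 else 0 :=
    ⟨reciprocalCoeff v, fun _ => reciprocalCoeff_eq_zero_of_even v,
      sum_mul_reciprocalCoeff_symmDiff (sum_mul_signVertex_ne_zero hw)⟩
  refine ⟨fun i S => -(v i * b (insert i S)), b, ?_⟩
  have hb : ∑ S with Odd #S, b S • ∏ j ∈ S, (X j : MvPolynomial (Fin n) ℚ) =
      ∑ S, b S • ∏ j ∈ S, X j := by
    refine sum_filter_of_ne fun S _ hS => ?_
    by_contra h
    exact hS (by rw [b_even S (Nat.not_odd_iff_even.mp h), zero_smul])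
  have hc : ∀ i, ∑ S with i ∉ S ∧ Even #S,
      (-(v i * b (insert i S))) • ∏ j ∈ S, (X j : MvPolynomial (Fin n) ℚ) =
        -(C (v i) * ∑ S with i ∉ S, b (insert i S) • ∏ j ∈ S, X j) := by
    intro i
    rw [← filter_filter, sum_filter_of_ne, mul_sum, ← sum_neg_distrib]
    · refine sum_congr rfl fun S _ => ?_
      rw [neg_smul, mul_smul, smul_eq_C_mul _ (v i)]
    · intro S hS hne
      by_contra h
      refine hne ?_
      have heven : Even #(insert i S) := by
        rw [card_insert_of_notMem (mem_filter.mp hS).2]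
        exact (Nat.not_even_iff_odd.mp h).add_one
      rw [b_even _ heven, mul_zero, neg_zero, zero_smul]
  have hL : ∑ i, C (v i) * ∑ S, b (S ∆ {i}) • ∏ j ∈ S, (X j : MvPolynomial (Fin n) ℚ) = 1 := by
    simp only [mul_sum, ← smul_eq_C_mul, smul_smul]
    rw [sum_comm]
    simp [← sum_smul, b_sum]
  rw [hb]
  simp only [hc]
  rw [mul_sum, ← sum_add_distrib]
  refine hL.symm.trans (sum_congr rfl fun i _ => ?_)
  rw [mul_left_comm, sum_smul_prod_X_mul_X]
  ring
end

section
/- Let n ≥ 1 and w : Fin n → ℤ, and suppose w is not partitionable. Let d = n if n is odd and d = n − 1 if n is even. Then there exist polynomials β₀ and β i (for i : Fin n) in MvPolynomial (Fin n) ℚ, each of total degree at most d, such that 1 = ∑_{i : Fin n} (β i) * (X i ^ 2 − 1) + β₀ * L. -/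
open Finset MvPolynomial

/-- For sign vectors, `∏ (1 + δ i * ε i)` is `2 ^ card ι` times the indicator of `δ = ε`. -/
theorem prod_one_add_signs {ι : Type*} [Fintype ι] [DecidableEq ι] (δ ε : ι → ℤˣ) :
    ∏ i, (1 + ((δ i : ℤ) : ℚ) * ((ε i : ℤ) : ℚ)) =
      if δ = ε then (2 : ℚ) ^ Fintype.card ι else 0 := by
  split_ifs with h
  · subst h
    have key (i : ι) : 1 + ((δ i : ℤ) : ℚ) * ((δ i : ℤ) : ℚ) = 2 := by
      rcases Int.units_eq_one_or (δ i) with h | h <;> norm_num [h]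
    simp [key]
  · obtain ⟨i, hi⟩ := Function.ne_iff.mp h
    refine Finset.prod_eq_zero (Finset.mem_univ i) ?_
    rcases Int.units_eq_one_or (δ i) with h₁ | h₁ <;>
      rcases Int.units_eq_one_or (ε i) with h₂ | h₂ <;> simp_all

/-- The sum of the odd-degree squarefree monomials. -/
theorem sum_odd_prod {ι : Type*} [Fintype ι] [DecidableEq ι] (y : ι → ℚ) :
    ∑ S : Finset ι with Odd #S, ∏ i ∈ S, y i =
      (∏ i, (1 + y i) - ∏ i, (1 + -y i)) / 2 := by
  rw [Finset.prod_one_add, Finset.prod_one_add, ← Finset.sum_sub_distrib, Finset.sum_div,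
    Finset.powerset_univ, Finset.sum_filter]
  refine Finset.sum_congr rfl fun S _ => ?_
  rw [Finset.prod_neg]
  split_ifs with h
  · rw [h.neg_one_pow]; ring
  · rw [(Nat.not_odd_iff_even.mp h).neg_one_pow]; ring

/-- An odd function on the sign cube is interpolated by a polynomial all of whose monomials are
squarefree of odd degree. -/
theorem exists_eval_signs_eq_of_odd {n : ℕ} (f : (Fin n → ℤˣ) → ℚ) (hf : ∀ ε, f (-ε) = -f ε) :
    ∃ p : MvPolynomial (Fin n) ℚ, p.totalDegree ≤ (if Odd n then n else n - 1) ∧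
      ∀ ε : Fin n → ℤˣ, eval (fun i => ((ε i : ℤ) : ℚ)) p = f ε := by
  refine ⟨∑ S : Finset (Fin n) with Odd #S,
    C ((2 ^ n)⁻¹ * ∑ δ : Fin n → ℤˣ, f δ * ∏ i ∈ S, ((δ i : ℤ) : ℚ)) * ∏ i ∈ S, X i, ?_, ?_⟩
  · refine totalDegree_finsetSum_le fun S hS => ?_
    have hodd : Odd #S := (Finset.mem_filter.mp hS).2
    have hle : #S ≤ n := by simpa using S.card_le_univ
    have hdeg : (∏ i ∈ S, X i : MvPolynomial (Fin n) ℚ).totalDegree ≤ #S :=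
      (totalDegree_finsetProd _ _).trans (by simp)
    refine (totalDegree_mul _ _).trans ?_
    rw [totalDegree_C, zero_add]
    refine hdeg.trans ?_
    split_ifs with h
    · exact hle
    · have : #S ≠ n := fun e => h (e ▸ hodd)
      omega
  · intro ε
    have hpt (δ : Fin n → ℤˣ) :
        ∑ S : Finset (Fin n) with Odd #S, ∏ i ∈ S, (((δ i : ℤ) : ℚ) * ((ε i : ℤ) : ℚ)) =
          ((if δ = ε then (2 : ℚ) ^ n else 0) - if δ = -ε then (2 : ℚ) ^ n else 0) / 2 := by
      have h₁ := prod_one_add_signs δ ε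
      have h₂ := prod_one_add_signs δ (-ε)
      simp only [Pi.neg_apply, Units.val_neg, Int.cast_neg, mul_neg, Fintype.card_fin] at h₁ h₂
      rw [sum_odd_prod, h₁, h₂]
    calc _ = (2 ^ n)⁻¹ * ∑ δ : Fin n → ℤˣ, f δ *
          ∑ S : Finset (Fin n) with Odd #S, ∏ i ∈ S, (((δ i : ℤ) : ℚ) * ((ε i : ℤ) : ℚ)) := by
          simp only [map_sum, map_mul, map_prod, eval_C, eval_X, Finset.mul_sum, Finset.sum_mul,
            Finset.prod_mul_distrib]
          rw [Finset.sum_comm]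
          refine Finset.sum_congr rfl fun δ _ => Finset.sum_congr rfl fun S _ => ?_
          ring
      _ = (2 ^ n)⁻¹ * ((f ε * 2 ^ n - f (-ε) * 2 ^ n) / 2) := by
          simp only [hpt, mul_div_assoc', mul_sub, mul_ite, mul_zero]
          rw [← Finset.sum_div, Finset.sum_sub_distrib]
          simp only [Finset.sum_ite_eq', Finset.mem_univ, if_true]
          ring
      _ = f ε := by
          rw [hf]
          field_simp
          ring

/-- A polynomial vanishing on the sign cube lies in the ideal of the `X i ^ 2 - 1`, with
coefficients of controlled degree. -/
theorem exists_eq_sum_mul_sq_sub_one {n : ℕ} (p : MvPolynomial (Fin n) ℚ)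
    (hp : ∀ ε : Fin n → ℤˣ, eval (fun i => ((ε i : ℤ) : ℚ)) p = 0) :
    ∃ β : Fin n → MvPolynomial (Fin n) ℚ, (∀ i, (β i).totalDegree ≤ p.totalDegree - 2) ∧
      p = ∑ i, β i * (X i ^ 2 - 1) := by
  have hfac (i : Fin n) :
      ∏ r ∈ ({1, -1} : Finset ℚ), (X i - C r : MvPolynomial (Fin n) ℚ) = X i ^ 2 - 1 := by
    rw [Finset.prod_pair (by norm_num)]
    simp only [map_neg, map_one]
    ring
  obtain ⟨h, hdeg, hsum⟩ := combinatorial_nullstellensatz_exists_linearCombination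
    (fun _ : Fin n => ({1, -1} : Finset ℚ)) (fun _ => ⟨1, by simp⟩) p (by
      intro x hx
      have (i : Fin n) : ∃ u : ℤˣ, ((u : ℤ) : ℚ) = x i := by
        rcases Finset.mem_insert.mp (hx i) with h | h
        · exact ⟨1, by simp [h]⟩
        · exact ⟨-1, by simp [Finset.mem_singleton.mp h]⟩
      choose ε hε using this
      simpa only [hε] using hp ε)
  simp only [hfac] at hdeg hsum
  refine ⟨h, fun i => ?_, ?_⟩
  · by_cases hi : h i = 0
    · simp [hi]
    have hcoeff : coeff (Finsupp.single i 2) (X i ^ 2 - 1 : MvPolynomial (Fin n) ℚ) = 1 := by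
      rw [coeff_sub, X_pow_eq_monomial, coeff_monomial, coeff_one]
      simp [eq_comm]
    have hne : (X i ^ 2 - 1 : MvPolynomial (Fin n) ℚ) ≠ 0 := by
      intro h0
      simp [h0] at hcoeff
    have h2 : 2 ≤ (X i ^ 2 - 1 : MvPolynomial (Fin n) ℚ).totalDegree := by
      have := le_totalDegree (p := (X i ^ 2 - 1 : MvPolynomial (Fin n) ℚ))
        (s := Finsupp.single i 2) (by rw [mem_support_iff, hcoeff]; exact one_ne_zero)
      simpa using this
    have := hdeg i
    rw [totalDegree_mul_of_isDomain hne hi] at this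
    omega
  · conv_lhs => rw [hsum]
    rw [Finsupp.linearCombination_apply, Finsupp.sum_fintype _ _ (by simp)]
    simp only [smul_eq_mul]

theorem sum_mul_signs_ne_zero {n : ℕ} {w : Fin n → ℤ} (hw : ¬ Partitionable n w)
    (ε : Fin n → ℤˣ) : ∑ i, (w i : ℚ) * ((ε i : ℤ) : ℚ) ≠ 0 := by
  intro h0
  have hZ : ∑ i, w i * (ε i : ℤ) = 0 := by exact_mod_cast h0
  refine hw ⟨Finset.univ.filter fun i => ε i = 1, ?_⟩
  rw [← Finset.sum_add_sum_compl (Finset.univ.filter fun i => ε i = 1)] at hZ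
  have h₁ : ∑ i with ε i = 1, w i * (ε i : ℤ) = ∑ i with ε i = 1, w i :=
    Finset.sum_congr rfl fun i hi => by simp [(Finset.mem_filter.mp hi).2]
  have h₂ : ∑ i ∈ (Finset.univ.filter fun i => ε i = 1)ᶜ, w i * (ε i : ℤ) =
      -∑ i ∈ (Finset.univ.filter fun i => ε i = 1)ᶜ, w i := by
    rw [← Finset.sum_neg_distrib]
    refine Finset.sum_congr rfl fun i hi => ?_
    have hi : ε i ≠ 1 := by simpa using hi
    simp [(Int.units_eq_one_or (ε i)).resolve_left hi]
  linarith

theorem stmt_2 (n : ℕ) (hn : 1 ≤ n) (w : Fin n → ℤ) (hw : ¬ Partitionable n w) :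
    ∃ (β₀ : MvPolynomial (Fin n) ℚ) (β : Fin n → MvPolynomial (Fin n) ℚ),
      β₀.totalDegree ≤ (if Odd n then n else n - 1) ∧
      (∀ i : Fin n, (β i).totalDegree ≤ (if Odd n then n else n - 1)) ∧
      (1 : MvPolynomial (Fin n) ℚ) =
        (∑ i : Fin n, β i * (X i ^ 2 - 1)) +
          β₀ * (∑ i : Fin n, C (w i : ℚ) * X i) := by
  obtain ⟨β₀, hdeg, heval⟩ := exists_eval_signs_eq_of_odd
    (fun ε : Fin n → ℤˣ => (∑ i, (w i : ℚ) * ((ε i : ℤ) : ℚ))⁻¹) (fun ε => by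
      simp [Finset.sum_neg_distrib, inv_neg])
  have hL : (∑ i : Fin n, C (w i : ℚ) * X i : MvPolynomial (Fin n) ℚ).totalDegree ≤ 1 :=
    totalDegree_finsetSum_le fun i _ => (totalDegree_mul _ _).trans (by
      rw [totalDegree_C, totalDegree_X])
  obtain ⟨β, hβ, hsum⟩ := exists_eq_sum_mul_sq_sub_one
    (1 - β₀ * ∑ i : Fin n, C (w i : ℚ) * X i) (fun ε => by
      simp [heval, inv_mul_cancel₀ (sum_mul_signs_ne_zero hw ε)])
  refine ⟨β₀, β, hdeg, fun i => (hβ i).trans ?_, ?_⟩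
  · have h₁ := totalDegree_sub (1 : MvPolynomial (Fin n) ℚ)
      (β₀ * ∑ i : Fin n, C (w i : ℚ) * X i)
    have h₂ := totalDegree_mul β₀ (∑ i : Fin n, C (w i : ℚ) * X i)
    rw [totalDegree_one] at h₁
    omega
  · rw [← hsum, sub_add_cancel]
end

section
/- Let n ≥ 1 and w : Fin n → ℤ. Then w is not partitionable if and only if there exist polynomials β₀ and β i (for i : Fin n) in MvPolynomial (Fin n) ℚ such that 1 = ∑_{i : Fin n} (β i) * (X i ^ 2 − 1) + β₀ * L. -/
open Finset MvPolynomial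

theorem sum_mul_ite_mem_one_neg_one {ι R : Type*} [Fintype ι] [DecidableEq ι] [Ring R]
    (w : ι → ℤ) (I : Finset ι) :
    ∑ i, (w i : R) * (if i ∈ I then 1 else -1) =
      ((∑ i ∈ I, w i - ∑ i ∈ Iᶜ, w i : ℤ) : R) := by
  rw [← Finset.sum_add_sum_compl I, Int.cast_sub, sub_eq_add_neg]
  congr 1
  · rw [Int.cast_sum]
    exact Finset.sum_congr rfl fun i hi => by simp [hi]
  · rw [Int.cast_sum, ← Finset.sum_neg_distrib]
    exact Finset.sum_congr rfl fun i hi => by simp [Finset.mem_compl.mp hi]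

/-- A zero of the linear form `∑ w i * x i` at a sign vector, over any domain of characteristic
zero, yields a partition of `w`. -/
theorem Partitionable.of_sum_mul_eq_zero {R : Type*} [CommRing R] [IsDomain R] [CharZero R]
    {n : ℕ} {w : Fin n → ℤ} {x : Fin n → R} (hx : ∀ i, x i ^ 2 = 1)
    (h : ∑ i, (w i : R) * x i = 0) : Partitionable n w := by
  classical
  refine ⟨Finset.univ.filter fun i => x i = 1, ?_⟩
  have key := sum_mul_ite_mem_one_neg_one (R := R) w (Finset.univ.filter fun i => x i = 1)
  have hsign : ∀ i, (if i ∈ Finset.univ.filter (fun i => x i = 1) then 1 else -1) = x i := by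
    intro i
    by_cases h1 : x i = 1
    · simp [h1]
    · simpa [h1] using ((mul_self_eq_one_iff.mp (by rw [← sq, hx i])).resolve_left h1).symm
  simp only [hsign, h] at key
  exact sub_eq_zero.mp (Int.cast_eq_zero.mp key.symm)

theorem stmt_4 (n : ℕ) (hn : 1 ≤ n) (w : Fin n → ℤ) :
    ¬ Partitionable n w ↔
      ∃ (β₀ : MvPolynomial (Fin n) ℚ) (β : Fin n → MvPolynomial (Fin n) ℚ),
        (1 : MvPolynomial (Fin n) ℚ) =
          (∑ i : Fin n, β i * (X i ^ 2 - 1)) +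
            β₀ * (∑ i : Fin n, C (w i : ℚ) * X i) := by
  constructor
  · intro hw
    set L : MvPolynomial (Fin n) ℚ := ∑ i : Fin n, C (w i : ℚ) * X i with hL
    set J : Ideal (MvPolynomial (Fin n) ℚ) :=
      Ideal.span (Set.range fun i => X i ^ 2 - 1) ⊔ Ideal.span {L} with hJ
    have htop : J = ⊤ := by
      by_contra hne
      obtain ⟨M, hM, hJM⟩ := Ideal.exists_le_maximal J hne
      let K := MvPolynomial (Fin n) ℚ ⧸ M
      let _ : Field K := Ideal.Quotient.field M
      have : CharZero K := algebraRat.charZero K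
      refine hw (Partitionable.of_sum_mul_eq_zero
        (x := fun i => (Ideal.Quotient.mk M (X i) : K)) (fun i => ?_) ?_)
      · have hi : (X i ^ 2 - 1 : MvPolynomial (Fin n) ℚ) ∈ M :=
          hJM (Ideal.mem_sup_left (Ideal.subset_span ⟨i, rfl⟩))
        have := Ideal.Quotient.eq_zero_iff_mem.mpr hi
        rwa [map_sub, map_pow, map_one, sub_eq_zero] at this
      · have hLM : L ∈ M := hJM (Ideal.mem_sup_right (Ideal.mem_span_singleton_self L))
        have := Ideal.Quotient.eq_zero_iff_mem.mpr hLM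
        simpa [hL, map_sum] using this
    obtain ⟨p, hp, q, hq, hpq⟩ := Submodule.mem_sup.mp ((Ideal.eq_top_iff_one J).mp htop)
    obtain ⟨β, rfl⟩ := Ideal.mem_span_range_iff_exists_fun.mp hp
    obtain ⟨β₀, rfl⟩ := Ideal.mem_span_singleton'.mp hq
    exact ⟨β₀, β, hpq.symm⟩
  · rintro ⟨β₀, β, h⟩ ⟨I, hI⟩
    have hsum := sum_mul_ite_mem_one_neg_one (R := ℚ) w I
    rw [hI, sub_self, Int.cast_zero] at hsum
    have hsq : ∀ i, (if i ∈ I then (1 : ℚ) else -1) ^ 2 = 1 := fun i => by split_ifs <;> norm_num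
    have := congrArg (eval fun i => if i ∈ I then (1 : ℚ) else -1) h
    simp only [map_add, map_sum, map_mul, map_sub, map_pow, map_one, eval_X, eval_C, hsq, hsum,
      sub_self, mul_zero, Finset.sum_const_zero, add_zero] at this
    exact one_ne_zero this
end

section
/- Let n ≥ 1 and write ℓ for the last element of Fin n. The map S ↦ S Δ {ℓ} is a bijection from the even-cardinality Finsets of Fin n to the odd-cardinality Finsets of Fin n, and it is order-preserving for graded reverse lexicographic order: for even-cardinality Finsets S and S', S ≺ S' if and only if S Δ {ℓ} ≺ S' Δ {ℓ}. -/
open Finset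

/-- The last element of `Fin n` (for `n ≥ 1`). -/
def lastIdx (n : ℕ) (hn : 1 ≤ n) : Fin n := ⟨n - 1, by omega⟩

/-- Graded reverse lexicographic order on subsets of `Fin n`:
`S ≺ S'` if either `S.card < S'.card`, or the cardinalities agree, `S ≠ S'`,
and the maximum element of the symmetric difference `S Δ S'` belongs to `S`. -/
def GrevlexLt {n : ℕ} (S S' : Finset (Fin n)) : Prop :=
  S.card < S'.card ∨
    (S.card = S'.card ∧ S ≠ S' ∧
      ∃ m : Fin n, (symmDiff S S').max = (m : WithBot (Fin n)) ∧ m ∈ S)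

theorem Finset.card_symmDiff_singleton_of_mem {α : Type*} [DecidableEq α] {S : Finset α} {a : α}
    (h : a ∈ S) : (symmDiff S {a}).card + 1 = S.card := by
  have : symmDiff S {a} = S.erase a := by
    ext x; simp only [mem_symmDiff, mem_singleton, mem_erase]; grind
  rw [this, card_erase_add_one h]

theorem Finset.card_symmDiff_singleton_of_notMem {α : Type*} [DecidableEq α] {S : Finset α} {a : α}
    (h : a ∉ S) : (symmDiff S {a}).card = S.card + 1 := by
  have : symmDiff S {a} = insert a S := by
    ext x; simp only [mem_symmDiff, mem_singleton, mem_insert]; grind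
  rw [this, card_insert_of_notMem h]

theorem Finset.even_card_symmDiff_singleton {α : Type*} [DecidableEq α] (S : Finset α) (a : α) :
    Even (symmDiff S {a}).card ↔ ¬ Even S.card := by
  by_cases h : a ∈ S
  · rw [← card_symmDiff_singleton_of_mem h, Nat.even_add_one, not_not]
  · rw [card_symmDiff_singleton_of_notMem h, Nat.even_add_one]

theorem le_lastIdx {n : ℕ} (hn : 1 ≤ n) (i : Fin n) : i ≤ lastIdx n hn := by
  simp only [lastIdx, Fin.le_def]
  omega

theorem Finset.max_eq_lastIdx {n : ℕ} {hn : 1 ≤ n} {S : Finset (Fin n)} (h : lastIdx n hn ∈ S) :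
    S.max = (lastIdx n hn : WithBot (Fin n)) :=
  le_antisymm (Finset.max_le fun i _ => WithBot.coe_le_coe.2 (le_lastIdx hn i)) (le_max h)

theorem GrevlexLt.symmDiff_lastIdx {n : ℕ} (hn : 1 ≤ n) {S S' : Finset (Fin n)}
    (hpar : Even S.card ↔ Even S'.card) (h : GrevlexLt S S') :
    GrevlexLt (symmDiff S {lastIdx n hn}) (symmDiff S' {lastIdx n hn}) := by
  have hdiff : symmDiff (symmDiff S {lastIdx n hn}) (symmDiff S' {lastIdx n hn}) =
      symmDiff S S' := by
    rw [symmDiff_symmDiff_symmDiff_comm, symmDiff_self, symmDiff_bot]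
  unfold GrevlexLt
  rw [hdiff]
  have hgap : S.card < S'.card → S.card + 2 ≤ S'.card := by
    rw [Nat.even_iff, Nat.even_iff] at hpar
    omega
  have hne : S ≠ S' → symmDiff S {lastIdx n hn} ≠ symmDiff S' {lastIdx n hn} :=
    fun hS => (symmDiff_left_injective _).ne hS
  have hmax : ∀ m : Fin n, (symmDiff S S').max = (m : WithBot (Fin n)) →
      lastIdx n hn ∈ symmDiff S S' → m = lastIdx n hn := fun m hm hl =>
    WithBot.coe_injective (hm.symm.trans (max_eq_lastIdx hl))
  by_cases hS : lastIdx n hn ∈ S <;> by_cases hS' : lastIdx n hn ∈ S'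
  · have c := card_symmDiff_singleton_of_mem hS
    have c' := card_symmDiff_singleton_of_mem hS'
    obtain h | ⟨hc, hSS, m, hm, hmS⟩ := h
    · left; omega
    · refine Or.inr ⟨by omega, hne hSS, m, hm, ?_⟩
      have := mem_of_max hm
      simp only [mem_symmDiff, mem_singleton] at this ⊢
      grind
  · have c := card_symmDiff_singleton_of_mem hS
    have c' := card_symmDiff_singleton_of_notMem hS'
    obtain h | ⟨hc, -⟩ := h <;> left <;> omega
  · have c := card_symmDiff_singleton_of_notMem hS
    have c' := card_symmDiff_singleton_of_mem hS'
    have hl : lastIdx n hn ∈ symmDiff S S' := mem_symmDiff.2 (Or.inr ⟨hS', hS⟩)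
    obtain h | ⟨-, -, m, hm, hmS⟩ := h
    · have h2 := hgap h
      obtain h3 | h3 := h2.lt_or_eq
      · left; omega
      · refine Or.inr ⟨by omega, hne fun e => hS (e ▸ hS'), _, max_eq_lastIdx hl, ?_⟩
        simp [mem_symmDiff, hS]
    · exact absurd (hmax m hm hl ▸ hmS) hS
  · have c := card_symmDiff_singleton_of_notMem hS
    have c' := card_symmDiff_singleton_of_notMem hS'
    obtain h | ⟨hc, hSS, m, hm, hmS⟩ := h
    · left; omega
    · refine Or.inr ⟨by omega, hne hSS, m, hm, ?_⟩
      simp only [mem_symmDiff, mem_singleton]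
      grind

theorem stmt_6 (n : ℕ) (hn : 1 ≤ n) :
    -- `S ↦ S Δ {ℓ}` is a bijection from the even-cardinality subsets of `Fin n`
    -- onto the odd-cardinality subsets of `Fin n`:
    Set.BijOn (fun S : Finset (Fin n) => symmDiff S {lastIdx n hn})
      {S : Finset (Fin n) | Even S.card} {S : Finset (Fin n) | Odd S.card} ∧
    -- and it is order-preserving for graded reverse lexicographic order:
    (∀ S S' : Finset (Fin n), Even S.card → Even S'.card →
      (GrevlexLt S S' ↔
        GrevlexLt (symmDiff S {lastIdx n hn}) (symmDiff S' {lastIdx n hn}))) := by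
  refine ⟨⟨?_, (symmDiff_left_injective _).injOn, ?_⟩, fun S S' hS hS' =>
    ⟨GrevlexLt.symmDiff_lastIdx hn (iff_of_true hS hS'), fun h => ?_⟩⟩
  · intro S hS
    simpa [← Nat.not_even_iff_odd, even_card_symmDiff_singleton] using hS
  · intro T hT
    refine ⟨symmDiff T {lastIdx n hn}, ?_, symmDiff_symmDiff_cancel_right _ _⟩
    simpa [even_card_symmDiff_singleton] using hT
  · have := h.symmDiff_lastIdx hn (by simp [even_card_symmDiff_singleton, hS, hS'])
    rwa [symmDiff_symmDiff_cancel_right, symmDiff_symmDiff_cancel_right] at this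
end

section
/- Let n ≥ 1 and regard each Π_k (k : Fin n) as a matrix over a commutative ring R. Then the matrices Π_k pairwise commute: for all k, l : Fin n, Π_k * Π_l = Π_l * Π_k. -/
open Finset

noncomputable section

/-- The even-cardinality subsets of `Fin n`, indexing the rows and columns of the
partition matrix. -/
abbrev EvenSets (n : ℕ) := {S : Finset (Fin n) // Even S.card}

/-- The partition matrix `Π(w)`: its `(S, S')` entry is `w k` if
`S Δ S' Δ {ℓ}` is the singleton `{k}` (where `ℓ` is the last element of `Fin n`),
and `0` otherwise. -/
def partitionMatrix {R : Type*} [CommRing R] (n : ℕ) (hn : 1 ≤ n) (w : Fin n → R) :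
    Matrix (EvenSets n) (EvenSets n) R :=
  Matrix.of fun S S' : EvenSets n =>
    ∑ k : Fin n,
      if symmDiff (symmDiff S.1 S'.1) {lastIdx n hn} = {k} then w k else 0

/-- The 0/1 matrix `Π_k`: its `(S, S')` entry is `1` if `S Δ S' Δ {ℓ} = {k}`,
and `0` otherwise. -/
def PiPerm (n : ℕ) (hn : 1 ≤ n) (R : Type*) [CommRing R] (k : Fin n) :
    Matrix (EvenSets n) (EvenSets n) R :=
  Matrix.of fun S S' : EvenSets n =>
    if symmDiff (symmDiff S.1 S'.1) {lastIdx n hn} = {k} then 1 else 0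

theorem even_card_symmDiff {α : Type*} [DecidableEq α] {S T : Finset α}
    (hS : Even S.card) (hT : Even T.card) : Even (symmDiff S T).card := by
  have h : (symmDiff S T).card = (S \ T).card + (T \ S).card :=
    Finset.card_union_of_disjoint disjoint_sdiff_sdiff
  have h₁ := Finset.card_sdiff_add_card_inter S T
  have h₂ := Finset.card_sdiff_add_card_inter T S
  rw [Finset.inter_comm] at h₂
  grind

/-- The reflection `T ↦ S Δ S' Δ T` of the even-cardinality subsets. -/
def EvenSets.reflection {n : ℕ} (S S' : EvenSets n) : Equiv.Perm (EvenSets n) :=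
  Function.Involutive.toPerm
    (fun T => ⟨symmDiff (symmDiff S.1 S'.1) T.1,
      even_card_symmDiff (even_card_symmDiff S.2 S'.2) T.2⟩)
    fun _ => Subtype.ext (symmDiff_symmDiff_cancel_left _ _)

theorem EvenSets.symmDiff_reflection_left {n : ℕ} (S S' T : EvenSets n) :
    symmDiff S.1 (reflection S S' T).1 = symmDiff T.1 S'.1 := by
  change symmDiff S.1 (symmDiff (symmDiff S.1 S'.1) T.1) = _
  rw [symmDiff_assoc, symmDiff_symmDiff_cancel_left, symmDiff_comm]

theorem EvenSets.symmDiff_reflection_right {n : ℕ} (S S' T : EvenSets n) :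
    symmDiff (reflection S S' T).1 S'.1 = symmDiff S.1 T.1 := by
  change symmDiff (symmDiff (symmDiff S.1 S'.1) T.1) S'.1 = _
  rw [symmDiff_right_comm, symmDiff_symmDiff_cancel_right]

/-- Matrices whose entries depend only on `S Δ S'` commute. -/
theorem EvenSets.of_symmDiff_mul_comm {R : Type*} [CommRing R] {n : ℕ}
    (f g : Finset (Fin n) → R) :
    (Matrix.of fun S S' : EvenSets n => f (symmDiff S.1 S'.1)) *
        (Matrix.of fun S S' : EvenSets n => g (symmDiff S.1 S'.1)) =
      (Matrix.of fun S S' : EvenSets n => g (symmDiff S.1 S'.1)) *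
        (Matrix.of fun S S' : EvenSets n => f (symmDiff S.1 S'.1)) := by
  ext S S'
  simp only [Matrix.mul_apply, Matrix.of_apply]
  rw [← Equiv.sum_comp (reflection S S')]
  simp only [symmDiff_reflection_left, symmDiff_reflection_right, mul_comm]

theorem stmt_13 (n : ℕ) (hn : 1 ≤ n) (R : Type*) [CommRing R] (k l : Fin n) :
    PiPerm n hn R k * PiPerm n hn R l = PiPerm n hn R l * PiPerm n hn R k := by
  exact EvenSets.of_symmDiff_mul_comm
    (fun D => if symmDiff D {lastIdx n hn} = {k} then 1 else 0)
    (fun D => if symmDiff D {lastIdx n hn} = {l} then 1 else 0)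
end
end

section
/- Let n ≥ 1, R a commutative ring, and w : Fin n → R. Then the determinant of the partition matrix equals the partition polynomial: det Π(w) = ∏_{s : Fin (n−1) → R, s i ∈ {−1, 1} for all i} ( (∑_{i : Fin (n−1)} s i * w (i.castSucc)) + w ℓ ). -/
open Finset

noncomputable section

/-- A block matrix `[A, B; B, A]` has determinant `det (A + B) * det (A - B)`. -/
theorem Matrix.det_fromBlocks_swap {m R : Type*} [Fintype m] [DecidableEq m] [CommRing R]
    (A B : Matrix m m R) :
    (Matrix.fromBlocks A B B A).det = (A + B).det * (A - B).det := by
  have h : Matrix.fromBlocks 1 0 (-1) 1 * Matrix.fromBlocks A B B A * Matrix.fromBlocks 1 0 1 1 =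
      Matrix.fromBlocks (A + B) B 0 (A - B) := by
    simp only [Matrix.fromBlocks_multiply]
    congr 1 <;> simp <;> abel
  have h' := congrArg Matrix.det h
  simpa [Matrix.det_mul] using h'

/-- The weighted adjacency matrix of the `m`-dimensional hypercube, with vertices the sign vectors,
weight `a` on the loops and weight `w i` on the edges in direction `i`. -/
def hypercubeMatrix {R : Type*} [CommRing R] (m : ℕ) (a : R) (w : Fin m → R) :
    Matrix (Fin m → ℤˣ) (Fin m → ℤˣ) R :=
  Matrix.of fun x y =>
    (∑ i, if x * y = Pi.mulSingle i (-1) then w i else 0) + if x * y = 1 then a else 0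

/-- Splitting the sign vectors according to their first coordinate. -/
def signConsEquiv (m : ℕ) : (Fin m → ℤˣ) ⊕ (Fin m → ℤˣ) ≃ (Fin (m + 1) → ℤˣ) :=
  Equiv.ofBijective
    (Sum.elim (fun x => Fin.cons 1 x) (fun x => Fin.cons (-1) x)) <| by
    constructor
    · rintro (x | x) (y | y) h <;> simp_all [Fin.cons_inj]
    · intro x
      rcases Int.units_eq_one_or (x 0) with h | h
      · exact ⟨Sum.inl (Fin.tail x), by simp [← h]⟩
      · exact ⟨Sum.inr (Fin.tail x), by simp [← h]⟩

@[simp]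
theorem signConsEquiv_inl {m : ℕ} (x : Fin m → ℤˣ) :
    signConsEquiv m (Sum.inl x) = Fin.cons 1 x := rfl

@[simp]
theorem signConsEquiv_inr {m : ℕ} (x : Fin m → ℤˣ) :
    signConsEquiv m (Sum.inr x) = Fin.cons (-1) x := rfl

theorem sign_mul_eq_one_iff {α : Type*} (x y : α → ℤˣ) : x * y = 1 ↔ x = y := by
  have : y⁻¹ = y := by ext i; simp
  rw [mul_eq_one_iff_eq_inv, this]

theorem Fin.cons_mul_cons {M : Type*} [Mul M] {m : ℕ} (a b : M) (x y : Fin m → M) :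
    (Fin.cons a x * Fin.cons b y : Fin (m + 1) → M) = Fin.cons (a * b) (x * y) := by
  ext i
  refine Fin.cases ?_ (fun j => ?_) i <;> simp

theorem Fin.mulSingle_zero_eq_cons {M : Type*} [One M] {m : ℕ} (a : M) :
    (Pi.mulSingle 0 a : Fin (m + 1) → M) = Fin.cons a 1 := by
  ext i
  refine Fin.cases ?_ (fun j => ?_) i <;> simp

theorem Fin.mulSingle_succ_eq_cons {M : Type*} [One M] {m : ℕ} (i : Fin m) (a : M) :
    (Pi.mulSingle i.succ a : Fin (m + 1) → M) = Fin.cons 1 (Pi.mulSingle i a) := by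
  ext j
  refine Fin.cases ?_ (fun j => ?_) j <;> simp [Pi.mulSingle_apply]

theorem Fin.cons_one_one {M : Type*} [One M] {m : ℕ} :
    (1 : Fin (m + 1) → M) = Fin.cons 1 1 := by
  ext j
  refine Fin.cases ?_ (fun j => ?_) j <;> simp

theorem hypercubeMatrix_succ_submatrix {R : Type*} [CommRing R] (m : ℕ) (a : R)
    (w : Fin (m + 1) → R) :
    (hypercubeMatrix (m + 1) a w).submatrix (signConsEquiv m) (signConsEquiv m) =
      Matrix.fromBlocks (hypercubeMatrix m a (Fin.tail w)) (w 0 • 1) (w 0 • 1)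
        (hypercubeMatrix m a (Fin.tail w)) := by
  ext (x | x) (y | y) <;>
    simp [hypercubeMatrix, Fin.sum_univ_succ, Fin.cons_mul_cons,
      Fin.mulSingle_zero_eq_cons, Fin.mulSingle_succ_eq_cons, Fin.cons_one_one, Fin.cons_inj,
      Fin.tail, sign_mul_eq_one_iff, Matrix.one_apply]

theorem hypercubeMatrix_add_smul_one {R : Type*} [CommRing R] (m : ℕ) (a b : R) (w : Fin m → R) :
    hypercubeMatrix m a w + b • 1 = hypercubeMatrix m (a + b) w := by
  ext x y
  by_cases h : x = y <;> simp [hypercubeMatrix, sign_mul_eq_one_iff, h, add_assoc]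

theorem det_hypercubeMatrix {R : Type*} [CommRing R] (m : ℕ) (a : R) (w : Fin m → R) :
    (hypercubeMatrix m a w).det =
      ∏ s : Fin m → ℤˣ, ((∑ i, ((s i : ℤ) : R) * w i) + a) := by
  induction m generalizing a with
  | zero => simp [hypercubeMatrix, Matrix.det_unique, Subsingleton.elim _ (1 : Fin 0 → ℤˣ)]
  | succ m ih =>
    rw [← Matrix.det_submatrix_equiv_self (signConsEquiv m), hypercubeMatrix_succ_submatrix,
      Matrix.det_fromBlocks_swap, sub_eq_add_neg, ← neg_smul, hypercubeMatrix_add_smul_one,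
      hypercubeMatrix_add_smul_one, ih, ih, ← Equiv.prod_comp (signConsEquiv m),
      Fintype.prod_sum_type]
    congr 1 <;> refine Finset.prod_congr rfl fun s _ => ?_ <;>
      simp [Fin.sum_univ_succ, Fin.tail] <;> ring

/-- The sign vector of a finset, equal to `-1` exactly on its elements. -/
def signVector {α : Type*} [DecidableEq α] (S : Finset α) : α → ℤˣ :=
  fun i => if i ∈ S then -1 else 1

theorem signVector_injective {α : Type*} [DecidableEq α] :
    Function.Injective (signVector : Finset α → α → ℤˣ) := by
  intro S T h
  ext i
  have := congrFun h i
  by_cases hS : i ∈ S <;> by_cases hT : i ∈ T <;> simp_all [signVector]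

theorem signVector_symmDiff {α : Type*} [DecidableEq α] (S T : Finset α) :
    signVector (symmDiff S T) = signVector S * signVector T := by
  ext i
  by_cases hS : i ∈ S <;> by_cases hT : i ∈ T <;>
    simp [signVector, Finset.mem_symmDiff, hS, hT]

theorem prod_signVector {α : Type*} [DecidableEq α] [Fintype α] (S : Finset α) :
    ∏ i, signVector S i = (-1) ^ S.card := by
  simp [signVector]

theorem eq_of_init_eq_of_prod_eq {M : Type*} [CommGroup M] {m : ℕ} {f g : Fin (m + 1) → M}
    (h : Fin.init f = Fin.init g) (hp : ∏ i, f i = ∏ i, g i) : f = g := by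
  have hi (i : Fin m) : f i.castSucc = g i.castSucc := congrFun h i
  rw [Fin.prod_univ_castSucc, Fin.prod_univ_castSucc] at hp
  simp only [hi, mul_right_inj] at hp
  ext i
  exact Fin.lastCases hp hi i

theorem Fin.init_mul {M : Type*} [Mul M] {m : ℕ} (f g : Fin (m + 1) → M) :
    Fin.init (f * g) = (Fin.init f * Fin.init g : Fin m → M) := rfl

theorem init_signVector_last (m : ℕ) :
    (Fin.init (signVector {Fin.last m}) : Fin m → ℤˣ) = 1 := by
  ext i
  simp [Fin.init, signVector, Fin.castSucc_ne_last]

theorem init_signVector_castSucc {m : ℕ} (i : Fin m) :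
    (Fin.init (signVector {i.castSucc}) : Fin m → ℤˣ) = Pi.mulSingle i (-1) := by
  ext j
  simp [Fin.init, signVector, Pi.mulSingle_apply]

/-- An even subset of `Fin (m + 1)` is determined by its sign vector away from the last element,
which is arbitrary. -/
def evenSetsEquiv (m : ℕ) : EvenSets (m + 1) ≃ (Fin m → ℤˣ) :=
  Equiv.ofBijective (fun S => Fin.init (signVector S.1)) <| by
    constructor
    · rintro ⟨S, hS⟩ ⟨T, hT⟩ h
      refine Subtype.ext (signVector_injective (eq_of_init_eq_of_prod_eq h ?_))
      rw [prod_signVector, prod_signVector, hS.neg_one_pow, hT.neg_one_pow]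
    · intro x
      let f : Fin (m + 1) → ℤˣ := Fin.snoc x (∏ i, x i)
      have hf : signVector (Finset.univ.filter fun i => f i = -1) = f := by
        ext i
        rcases Int.units_eq_one_or (f i) with h | h <;> simp [signVector, h]
      have hp : ∏ i, f i = 1 := by
        simp [f, Fin.prod_univ_castSucc, Int.units_mul_self]
      refine ⟨⟨Finset.univ.filter fun i => f i = -1, ?_⟩, ?_⟩
      · rw [← hf, prod_signVector] at hp
        by_contra h
        rw [Nat.not_even_iff_odd] at h
        rw [h.neg_one_pow] at hp
        exact absurd hp (by decide)
      · simp only [hf]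
        simp [f]

theorem symmDiff_singleton_last_eq_iff {m : ℕ} (S T : EvenSets (m + 1)) (k : Fin (m + 1)) :
    symmDiff (symmDiff S.1 T.1) {Fin.last m} = {k} ↔
      evenSetsEquiv m S * evenSetsEquiv m T = Fin.init (signVector {k}) := by
  have h : Fin.init (signVector (symmDiff (symmDiff S.1 T.1) {Fin.last m})) =
      evenSetsEquiv m S * evenSetsEquiv m T := by
    rw [signVector_symmDiff, signVector_symmDiff, Fin.init_mul, Fin.init_mul,
      init_signVector_last, mul_one]
    rfl
  rw [← h]
  refine ⟨fun h => by rw [h], fun h => signVector_injective (eq_of_init_eq_of_prod_eq h ?_)⟩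
  simp [signVector_symmDiff, Finset.prod_mul_distrib, prod_signVector, S.2.neg_one_pow,
    T.2.neg_one_pow]

theorem partitionMatrix_eq_submatrix {R : Type*} [CommRing R] (m : ℕ) (hm : 1 ≤ m + 1)
    (w : Fin (m + 1) → R) :
    partitionMatrix (m + 1) hm w =
      (hypercubeMatrix m (w (Fin.last m)) (fun i => w i.castSucc)).submatrix
        (evenSetsEquiv m) (evenSetsEquiv m) := by
  ext S T
  have hl : lastIdx (m + 1) hm = Fin.last m := rfl
  simp [partitionMatrix, hypercubeMatrix, hl, symmDiff_singleton_last_eq_iff,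
    Fin.sum_univ_castSucc, init_signVector_last, init_signVector_castSucc]

theorem stmt_15 (n : ℕ) (hn : 1 ≤ n) {R : Type*} [CommRing R] (w : Fin n → R) :
    (partitionMatrix n hn w).det =
      ∏ s : Fin (n - 1) → ℤˣ,
        ((∑ i : Fin (n - 1), ((s i : ℤ) : R) * w (Fin.castLE (by omega) i)) +
          w (lastIdx n hn)) := by
  obtain ⟨m, rfl⟩ : ∃ m, n = m + 1 := ⟨n - 1, by omega⟩
  rw [partitionMatrix_eq_submatrix, Matrix.det_submatrix_equiv_self, det_hypercubeMatrix]
  rfl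
end
end

section
/- Let n ≥ 1 and w : Fin n → ℤ. Then w is partitionable if and only if the determinant of the partition matrix Π(w) (over ℤ) is zero. -/
open Finset

noncomputable section

/-- The sign character of `Finset α` attached to `T`: the value `(-1) ^ #(S ∩ T)`. -/
def setSign {α : Type*} [DecidableEq α] (S T : Finset α) : ℤ :=
  ∏ i ∈ T, if i ∈ S then -1 else 1

section SetSign

variable {α : Type*} [DecidableEq α]

lemma setSign_eq_neg_one_pow (S T : Finset α) : setSign S T = (-1) ^ #(S ∩ T) := by
  rw [setSign, Finset.prod_ite, Finset.prod_const, Finset.prod_const_one, mul_one,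
    Finset.filter_mem_eq_inter, Finset.inter_comm]

lemma setSign_comm (S T : Finset α) : setSign S T = setSign T S := by
  rw [setSign_eq_neg_one_pow, setSign_eq_neg_one_pow, Finset.inter_comm]

lemma setSign_symmDiff (S S' T : Finset α) :
    setSign (symmDiff S S') T = setSign S T * setSign S' T := by
  rw [setSign, setSign, setSign, ← Finset.prod_mul_distrib]
  refine Finset.prod_congr rfl fun i _ => ?_
  by_cases h : i ∈ S <;> by_cases h' : i ∈ S' <;> simp [Finset.mem_symmDiff, h, h']

lemma setSign_singleton (k : α) (T : Finset α) :
    setSign {k} T = if k ∈ T then -1 else 1 := by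
  rw [setSign_comm, setSign, Finset.prod_singleton]

lemma setSign_ne_zero (S T : Finset α) : setSign S T ≠ 0 := by
  rw [setSign_eq_neg_one_pow]
  exact pow_ne_zero _ (by norm_num)

variable [Fintype α]

lemma setSign_univ_eq_one_iff (S : Finset α) : setSign S univ = 1 ↔ Even #S := by
  rw [setSign_eq_neg_one_pow, Finset.inter_univ, neg_one_pow_eq_one_iff_even (by norm_num)]

lemma sum_setSign (S : Finset α) :
    ∑ T, setSign S T = if S = ∅ then 2 ^ Fintype.card α else 0 := by
  have h : ∑ T, setSign S T = ∏ i : α, (1 + if i ∈ S then (-1 : ℤ) else 1) := by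
    rw [Finset.prod_one_add, Finset.powerset_univ]
    rfl
  rw [h]
  split_ifs with hS
  · subst hS
    norm_num
  · obtain ⟨i, hi⟩ := Finset.nonempty_iff_ne_empty.mpr hS
    exact Finset.prod_eq_zero (Finset.mem_univ i) (by simp [hi])

lemma sum_setSign_mul_setSign (S S' : Finset α) :
    ∑ T, setSign S T * setSign S' T = if S = S' then 2 ^ Fintype.card α else 0 := by
  simp_rw [← setSign_symmDiff, sum_setSign, ← Finset.bot_eq_empty, symmDiff_eq_bot]

/-- An integer function on a family of sets orthogonal to all sign characters vanishes. -/
lemma eq_zero_of_sum_setSign_mul_eq_zero {p : Finset α → Prop} [DecidablePred p]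
    (v : {S : Finset α // p S} → ℤ) (h : ∀ T, ∑ S, setSign S.1 T * v S = 0) : v = 0 := by
  funext S₀
  have key : ∑ T, setSign S₀.1 T * ∑ S, setSign S.1 T * v S =
      2 ^ Fintype.card α * v S₀ := by
    simp_rw [Finset.mul_sum]
    rw [Finset.sum_comm]
    simp_rw [← mul_assoc, ← Finset.sum_mul, sum_setSign_mul_setSign, ite_mul, zero_mul,
      ← Subtype.ext_iff]
    simp
  simp_rw [h, mul_zero, Finset.sum_const_zero] at key
  exact (mul_eq_zero.mp key.symm).resolve_left (by positivity)

lemma even_card_symmDiff_pair {S : Finset α} (hS : Even #S) (a b : α) :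
    Even #(symmDiff (symmDiff S {a}) {b}) := by
  rw [← setSign_univ_eq_one_iff] at hS ⊢
  simp [setSign_symmDiff, setSign_singleton, hS]

end SetSign

lemma symmDiff_symmDiff_eq_iff {α : Type*} [DecidableEq α] (S S' A B : Finset α) :
    symmDiff (symmDiff S S') A = B ↔ S = symmDiff (symmDiff S' A) B := by
  rw [symmDiff_assoc]
  constructor
  · rintro rfl
    rw [symmDiff_comm S, symmDiff_symmDiff_cancel_left]
  · rintro rfl
    rw [symmDiff_comm, symmDiff_symmDiff_cancel_left]

/-- The signed sum of the weights, counting those in `T` negatively. -/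
def signedSum {n : ℕ} (w : Fin n → ℤ) (T : Finset (Fin n)) : ℤ :=
  ∑ k, w k * setSign {k} T

lemma signedSum_eq {n : ℕ} (w : Fin n → ℤ) (T : Finset (Fin n)) :
    signedSum w T = ∑ i ∈ Tᶜ, w i - ∑ i ∈ T, w i := by
  rw [signedSum, ← Finset.sum_compl_add_sum T, sub_eq_add_neg, ← Finset.sum_neg_distrib]
  congr 1
  · exact Finset.sum_congr rfl fun i hi => by
      simp [setSign_singleton, Finset.mem_compl.mp hi]
  · exact Finset.sum_congr rfl fun i hi => by simp [setSign_singleton, hi]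

lemma partitionable_iff_exists_signedSum_eq_zero {n : ℕ} (w : Fin n → ℤ) :
    Partitionable n w ↔ ∃ T, signedSum w T = 0 := by
  simp_rw [Partitionable, signedSum_eq, sub_eq_zero, eq_comm]

/-- Each sign character is a left eigenvector of the partition matrix. -/
lemma setSign_vecMul_partitionMatrix (n : ℕ) (hn : 1 ≤ n) (w : Fin n → ℤ)
    (T : Finset (Fin n)) :
    Matrix.vecMul (fun S : EvenSets n => setSign S.1 T) (partitionMatrix n hn w) =
      (setSign {lastIdx n hn} T * signedSum w T) • fun S : EvenSets n => setSign S.1 T := by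
  funext S'
  simp only [Matrix.vecMul, dotProduct, partitionMatrix, Matrix.of_apply, Finset.mul_sum,
    Pi.smul_apply, smul_eq_mul, signedSum, Finset.sum_mul]
  rw [Finset.sum_comm]
  refine Finset.sum_congr rfl fun k _ => ?_
  rw [Finset.sum_eq_single
    ⟨_, even_card_symmDiff_pair S'.2 (lastIdx n hn) k⟩]
  · rw [if_pos ((symmDiff_symmDiff_eq_iff _ _ _ _).mpr rfl)]
    simp only [setSign_symmDiff]
    ring
  · intro S _ hS
    rw [if_neg, mul_zero]
    exact fun h => hS (Subtype.ext ((symmDiff_symmDiff_eq_iff _ _ _ _).mp h))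
  · exact fun h => absurd (Finset.mem_univ _) h

theorem stmt_16 (n : ℕ) (hn : 1 ≤ n) (w : Fin n → ℤ) :
    Partitionable n w ↔ (partitionMatrix n hn w).det = 0 := by
  rw [partitionable_iff_exists_signedSum_eq_zero]
  constructor
  · rintro ⟨T, hT⟩
    refine Matrix.exists_vecMul_eq_zero_iff.mp ⟨fun S => setSign S.1 T, fun h => ?_, ?_⟩
    · exact setSign_ne_zero ∅ T (congrFun h ⟨∅, by simp⟩)
    · rw [setSign_vecMul_partitionMatrix, hT, mul_zero, zero_smul]
  · intro hdet
    obtain ⟨v, hv, hMv⟩ := Matrix.exists_mulVec_eq_zero_iff.mpr hdet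
    by_contra! hT
    refine hv (eq_zero_of_sum_setSign_mul_eq_zero v fun T => ?_)
    have h := Matrix.dotProduct_mulVec (fun S : EvenSets n => setSign S.1 T)
      (partitionMatrix n hn w) v
    rw [hMv, dotProduct_zero, setSign_vecMul_partitionMatrix, smul_dotProduct, smul_eq_mul] at h
    exact (mul_eq_zero.mp h.symm).resolve_left (mul_ne_zero (setSign_ne_zero _ _) (hT T))
end
end
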